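/- arXiv:0708.3257 — 3 statements merged into one kernel-verified Lean document; each statement's English description precedes it below -/
import Mathlib

section
/- Fix an even integer q = 2p with p ≥ 2 and let λ = 2·cos(π/q). For all (t,v) ∈ ℝ² with −2/(3λ) ≤ t ≤ −1/(λ+1) and −2 − 1/t < v ≤ λ−1, one has −t/(1 + tv) ≤ 2/(λ+2), with equality if and only if t = −2/(3λ) and v = λ−1. (That is, the maximum of Θ_n = −t/(1+tv) over the region A is 2/(λ+2), attained at the upper-left corner (−2/(3λ), λ−1).) -/
noncomputable section

open Real Filter Topology MeasureTheory
open scoped Classical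

namespace RosenTong

/-- `λ_q = 2 cos(π/q)`. -/
def lam (q : ℕ) : ℝ := 2 * Real.cos (Real.pi / q)

/-- The Rosen map `f_q` on `[-λ/2, λ/2)`. -/
def f (l : ℝ) (x : ℝ) : ℝ :=
  if x = 0 then 0 else 1 / |x| - l * (⌊1 / (l * |x|) + 1 / 2⌋ : ℝ)

/-- `x` is `G_q`-irrational: its Rosen orbit never hits `0`. -/
def Irr (l : ℝ) (x : ℝ) : Prop := ∀ n : ℕ, (f l)^[n] x ≠ 0

/-- `ε_n = sign (f^{n-1} x)` (for `n ≥ 1`). -/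
def eps (l x : ℝ) (n : ℕ) : ℝ := Real.sign ((f l)^[n - 1] x)

/-- `r_n = ⌊1/(λ |f^{n-1} x|) + 1/2⌋` (for `n ≥ 1`), as a real number. -/
def rr (l x : ℝ) (n : ℕ) : ℝ := (⌊1 / (l * |(f l)^[n - 1] x|) + 1 / 2⌋ : ℝ)

/-- `((R_{n-1}, R_n), (S_{n-1}, S_n))`. -/
def RS (l x : ℝ) : ℕ → (ℝ × ℝ) × (ℝ × ℝ)
  | 0 => ((1, 0), (0, 1))
  | n + 1 =>
      (((RS l x n).1.2, rr l x (n + 1) * l * (RS l x n).1.2 + eps l x (n + 1) * (RS l x n).1.1),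
       ((RS l x n).2.2, rr l x (n + 1) * l * (RS l x n).2.2 + eps l x (n + 1) * (RS l x n).2.1))

/-- Numerator `R_n` of the `n`-th Rosen convergent. -/
def Rnum (l x : ℝ) (n : ℕ) : ℝ := (RS l x n).1.2

/-- Denominator `S_n` of the `n`-th Rosen convergent. -/
def Snum (l x : ℝ) (n : ℕ) : ℝ := (RS l x n).2.2

/-- The approximation coefficient `Θ_n = S_n² |x - R_n/S_n|`. -/
def theta (l x : ℝ) (n : ℕ) : ℝ := (Snum l x n) ^ 2 * |x - Rnum l x n / Snum l x n|

/-- The natural extension map `𝒯(x,y) = (f x, 1/(r(x)λ + ε(x) y))`. -/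
def T (l : ℝ) (z : ℝ × ℝ) : ℝ × ℝ :=
  (f l z.1, 1 / ((⌊1 / (l * |z.1|) + 1 / 2⌋ : ℝ) * l + Real.sign z.1 * z.2))

/-- `(t_n, v_n) = 𝒯^n (x, 0)`. -/
def tv (l x : ℝ) (n : ℕ) : ℝ × ℝ := (T l)^[n] (x, 0)

/-- `G(y) = -1/(λ + y)`. -/
def G (l : ℝ) (y : ℝ) : ℝ := -1 / (l + y)

/-- `C(y) = -1/(2λ + y)`. -/
def CC (l : ℝ) (y : ℝ) : ℝ := -1 / (2 * l + y)

/-- `τ_k` in the even case `q = 2p`. -/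
def tauE (l : ℝ) (p : ℕ) : ℕ → ℝ
  | 0 => -2 / (3 * l)
  | k + 1 => -1 / (2 * l + (G l)^[p - 2] (tauE l p k))

/-- `τ_k` in the odd case `q = 2h+3`. -/
def tauO (l : ℝ) (h : ℕ) : ℕ → ℝ
  | 0 => -2 / (3 * l)
  | k + 1 => CC l ((G l)^[h] (CC l ((G l)^[h - 1] (tauO l h k))))

/-- `φ_j = f^j(-λ/2)`. -/
def phi (l : ℝ) (j : ℕ) : ℝ := (f l)^[j] (-(l / 2))

/-- The heights `L_j` in the even case: `L_1 = 1/(λ+1)`, `L_j = 1/(λ - L_{j-1})`. -/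
def LE (l : ℝ) : ℕ → ℝ
  | 0 => 0
  | 1 => 1 / (l + 1)
  | j + 2 => 1 / (l - LE l (j + 1))

/-- The natural extension domain `Ω` in the even case `q = 2p`. -/
def OmegaE (l : ℝ) (p : ℕ) : Set (ℝ × ℝ) :=
  (⋃ j ∈ Finset.Icc 1 (p - 1),
    (Set.Ico (phi l (j - 1)) (phi l j)) ×ˢ (Set.Icc 0 (LE l j)))
  ∪ (Set.Ico (0 : ℝ) (l / 2)) ×ˢ (Set.Icc (0 : ℝ) 1)

/-- The region `D` (even case): both `Θ_{n-1}` and `Θ_n` exceed `1/2`. -/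
def DE (l : ℝ) (p : ℕ) : Set (ℝ × ℝ) :=
  {z ∈ OmegaE l p | z.2 / (1 + z.1 * z.2) > 1 / 2 ∧ |z.1| / (1 + z.1 * z.2) > 1 / 2}

/-- The region `A = {(t,v) ∈ D : -2/(3λ) ≤ t ≤ -1/(λ+1)}`. -/
def AE (l : ℝ) (p : ℕ) : Set (ℝ × ℝ) :=
  {z ∈ DE l p | -2 / (3 * l) ≤ z.1 ∧ z.1 ≤ -1 / (l + 1)}

/-- `A_k = {(t,v) ∈ A : t ≥ τ_k}`. -/
def AEk (l : ℝ) (p k : ℕ) : Set (ℝ × ℝ) :=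
  {z ∈ AE l p | tauE l p k ≤ z.1}

/-- The invariant measure `ν` (even case), with density `C_q/(1+tv)²` on `Ω`. -/
def nuE (q p : ℕ) : Measure (ℝ × ℝ) :=
  (volume.restrict (OmegaE (lam q) p)).withDensity fun z =>
    ENNReal.ofReal
      ((1 / Real.log ((1 + Real.cos (Real.pi / q)) / Real.sin (Real.pi / q))) /
        (1 + z.1 * z.2) ^ 2)

/-- The Hurwitz constant `H_q` for odd `q`. -/
def Hodd (l : ℝ) : ℝ := 1 / (2 * Real.sqrt ((1 - l / 2) ^ 2 + 1) )

/-- The positive root `R` of `R² + (2-λ)R - 1 = 0` (odd case). -/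
def Rodd (l : ℝ) : ℝ := (l - 2 + Real.sqrt ((2 - l) ^ 2 + 4)) / 2

lemma lam_pos {q : ℕ} (hq : 3 ≤ q) : 0 < lam q := by
  have hq' : (3 : ℝ) ≤ q := by exact_mod_cast hq
  have hlt : Real.pi / q < Real.pi / 2 :=
    div_lt_div_of_pos_left Real.pi_pos two_pos (by linarith)
  have hnonneg : 0 ≤ Real.pi / q := by positivity
  exact mul_pos two_pos (Real.cos_pos_of_mem_Ioo ⟨by linarith [Real.pi_pos], hlt⟩)

/-- the maximum of `Θ_n = -t/(1+tv)` on `A` is `2/(λ+2)`, at `(-2/(3λ), λ-1)`. -/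
theorem max_theta_on_A_even (q p : ℕ) (hp : 2 ≤ p) (hq : q = 2 * p) (t v : ℝ)
    (ht1 : -2 / (3 * lam q) ≤ t) (ht2 : t ≤ -1 / (lam q + 1))
    (hv1 : -2 - 1 / t < v) (hv2 : v ≤ lam q - 1) :
    -t / (1 + t * v) ≤ 2 / (lam q + 2) ∧
    (-t / (1 + t * v) = 2 / (lam q + 2) ↔ t = -2 / (3 * lam q) ∧ v = lam q - 1) := by
  have hl : 0 < lam q := lam_pos (by omega)
  generalize lam q = l at *
  have hs : 0 < -t := by
    have : -1 / (l + 1) < 0 := div_neg_of_neg_of_pos (by norm_num) (by linarith)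
    linarith
  have hcorner : 0 ≤ 2 + 3 * l * t := by
    rw [div_le_iff₀ (by positivity)] at ht1
    linarith
  have hheight : 0 ≤ -t * (l - 1 - v) := mul_nonneg hs.le (by linarith)
  have hpos : 0 < 1 + t * v := by nlinarith [mul_pos hs hl]
  constructor
  · rw [div_le_div_iff₀ hpos (by linarith)]
    linarith
  · rw [div_eq_div_iff hpos.ne' (by linarith), eq_div_iff (by positivity)]
    constructor
    · intro h
      have hv : -t * (l - 1 - v) = 0 := by linarith
      exact ⟨by linarith, by linarith [(mul_eq_zero.mp hv).resolve_left hs.ne']⟩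
    · rintro ⟨h, rfl⟩
      linarith

end RosenTong
end
end

section
/- Fix an even integer q = 2p with p ≥ 2 and let λ = 2·cos(π/q). The sequence (τ_k)_{k ≥ 0} is strictly increasing and converges to −1/(λ+1); consequently the sequence c_k = −τ_k/(1 + (λ−1)·τ_k) is strictly decreasing and converges to 1/2 as k → ∞. -/
noncomputable section

open Real Filter Topology MeasureTheory
open scoped Classical

namespace RosenTong

theorem two_cos_mul_sin (t x : ℝ) :
    2 * Real.cos t * Real.sin (x * t) = Real.sin ((x + 1) * t) + Real.sin ((x - 1) * t) := by
  rw [show (x + 1) * t = x * t + t by ring, show (x - 1) * t = x * t - t by ring,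
    Real.sin_add, Real.sin_sub]
  ring

theorem sin_mul_add_sin_pos {t y : ℝ} {j : ℕ} (ht : 0 < t)
    (hj : ((j : ℝ) + 1) * t ≤ Real.pi / 2) (hy : -1 < y) :
    0 < Real.sin (j * t) * y + Real.sin (((j : ℝ) + 1) * t) := by
  have hjt : 0 ≤ (j : ℝ) * t := by positivity
  have hlt : Real.sin (j * t) < Real.sin (((j : ℝ) + 1) * t) :=
    Real.sin_lt_sin_of_lt_of_le_pi_div_two (by linarith [Real.pi_pos]) hj (by linarith)
  have hnn : 0 ≤ Real.sin (j * t) :=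
    Real.sin_nonneg_of_nonneg_of_le_pi hjt (by linarith [Real.pi_pos])
  nlinarith

theorem G_iterate {t y : ℝ} (ht : 0 < t) (hy : -1 < y) :
    ∀ j : ℕ, ((j : ℝ) + 1) * t ≤ Real.pi / 2 →
      (G (2 * Real.cos t))^[j] y =
        -(Real.sin (((j : ℝ) - 1) * t) * y + Real.sin (j * t)) /
          (Real.sin (j * t) * y + Real.sin (((j : ℝ) + 1) * t))
  | 0, h => by
    have hs : 0 < Real.sin t :=
      Real.sin_pos_of_pos_of_lt_pi ht (by norm_num at h; linarith [Real.pi_pos])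
    simp [hs.ne']
  | j + 1, h => by
    push_cast at h
    have hj : ((j : ℝ) + 1) * t ≤ Real.pi / 2 := by linarith
    have hne := (sin_mul_add_sin_pos ht hj hy).ne'
    rw [Function.iterate_succ_apply', G_iterate ht hy j hj, G]
    have h₁ := two_cos_mul_sin t j
    have h₂ := two_cos_mul_sin t ((j : ℝ) + 1)
    rw [add_sub_cancel_right] at h₂
    have hsum : 2 * Real.cos t + -(Real.sin (((j : ℝ) - 1) * t) * y + Real.sin (j * t)) /
          (Real.sin (j * t) * y + Real.sin (((j : ℝ) + 1) * t)) =
        (Real.sin (((j : ℝ) + 1) * t) * y + Real.sin (((j : ℝ) + 1 + 1) * t)) /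
          (Real.sin (j * t) * y + Real.sin (((j : ℝ) + 1) * t)) := by
      rw [eq_div_iff hne, add_mul, div_mul_cancel₀ _ hne]
      linear_combination y * h₁ + h₂
    rw [hsum]
    push_cast
    rw [add_sub_cancel_right, div_div_eq_mul_div]
    ring

theorem sqrt_two_le_lam {q : ℕ} (hq : 4 ≤ q) : √2 ≤ lam q := by
  have hq' : (4 : ℝ) ≤ q := by exact_mod_cast hq
  have h : Real.cos (Real.pi / 4) ≤ Real.cos (Real.pi / q) :=
    Real.cos_le_cos_of_nonneg_of_le_pi (by positivity) (by linarith [Real.pi_pos])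
      (by gcongr)
  rw [Real.cos_pi_div_four] at h
  unfold lam
  linarith

theorem lam_lt_two {q : ℕ} (hq : 4 ≤ q) : lam q < 2 := by
  have hq' : (4 : ℝ) ≤ q := by exact_mod_cast hq
  have h : Real.cos (Real.pi / q) < Real.cos 0 :=
    Real.cos_lt_cos_of_nonneg_of_le_pi le_rfl
      (div_le_self Real.pi_pos.le (by linarith)) (by positivity)
  rw [Real.cos_zero] at h
  unfold lam
  linarith

/-- One step `τ_k ↦ τ_{k+1}` is a Möbius map with fixed points `-1/(λ+1)` and `-1/(λ-1)`. -/
theorem tauE_step {q p : ℕ} (hp : 2 ≤ p) (hq : q = 2 * p) {y : ℝ} (hy : -1 < y) :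
    -1 / (2 * lam q + (G (lam q))^[p - 2] y) =
      -((lam q ^ 2 - 2) * y + lam q) / ((lam q ^ 3 - lam q) * y + (lam q ^ 2 + 2)) := by
  obtain ⟨m, rfl⟩ := Nat.exists_eq_add_of_le' hp
  rw [Nat.add_sub_cancel]
  have hq0 : (0 : ℝ) < q := by rw [hq]; positivity
  have hqm : (q : ℝ) = 2 * (m + 2) := by rw [hq]; push_cast; ring
  set t := Real.pi / q with ht
  have htpos : 0 < t := by positivity
  have hmt : ((m : ℝ) + 2) * t = Real.pi / 2 := by rw [ht, hqm]; field_simp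
  have hle : ((m : ℝ) + 1) * t ≤ Real.pi / 2 := by linarith
  have hpos := sin_mul_add_sin_pos htpos hle hy
  have hs₁ : Real.sin (((m : ℝ) + 1) * t) = Real.cos t := by
    rw [← Real.sin_pi_div_two_sub, ← hmt]; ring_nf
  have hs₂ : Real.sin ((m : ℝ) * t) = 2 * Real.cos t ^ 2 - 1 := by
    rw [← Real.cos_two_mul, ← Real.sin_pi_div_two_sub, ← hmt]; ring_nf
  have hs₃ : Real.sin (((m : ℝ) - 1) * t) = 4 * Real.cos t ^ 3 - 3 * Real.cos t := by
    rw [← Real.cos_three_mul, ← Real.sin_pi_div_two_sub, ← hmt]; ring_nf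
  rw [show lam q = 2 * Real.cos t from rfl, G_iterate htpos hy m hle, hs₁, hs₂, hs₃]
  rw [hs₁, hs₂] at hpos
  generalize Real.cos t = c at *
  have hne := hpos.ne'
  have hsum : 2 * (2 * c) + -((4 * c ^ 3 - 3 * c) * y + (2 * c ^ 2 - 1)) /
        ((2 * c ^ 2 - 1) * y + c) =
      (((2 * c) ^ 3 - 2 * c) * y + ((2 * c) ^ 2 + 2)) / (2 * ((2 * c ^ 2 - 1) * y + c)) := by
    rw [eq_div_iff (mul_ne_zero two_ne_zero hne), add_mul, mul_left_comm (_ / _),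
      div_mul_cancel₀ _ hne]
    ring
  rw [hsum, div_div_eq_mul_div]
  ring

/-- Closed form of `τ_k`, in terms of the multiplier `(2-λ)/(2+λ)` at the fixed point. -/
theorem tauE_eq {q p : ℕ} (hp : 2 ≤ p) (hq : q = 2 * p) (k : ℕ) :
    tauE (lam q) p k = -(1 + ((2 - lam q) / (2 + lam q)) ^ (k + 1)) /
      ((lam q + 1) + (lam q - 1) * ((2 - lam q) / (2 + lam q)) ^ (k + 1)) := by
  have h1 : 1 < lam q :=
    Real.one_lt_sqrt_two.trans_le (sqrt_two_le_lam (by omega))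
  have h2 : lam q < 2 := lam_lt_two (by omega)
  induction k with
  | zero =>
    have : 0 < lam q + 1 + (lam q - 1) * ((2 - lam q) / (2 + lam q)) := by
      have : 0 < (2 - lam q) / (2 + lam q) := div_pos (by linarith) (by linarith)
      nlinarith
    rw [tauE, zero_add, pow_one, div_eq_div_iff (by linarith) this.ne']
    field_simp
    ring
  | succ k ih =>
    have hr0 : 0 < (2 - lam q) / (2 + lam q) := div_pos (by linarith) (by linarith)
    have hr1 : (2 - lam q) / (2 + lam q) < 1 := by rw [div_lt_one (by linarith)]; linarith
    rw [pow_succ _ (k + 1)]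
    have hx0 := pow_pos hr0 (k + 1)
    have hx1 := pow_le_one₀ (n := k + 1) hr0.le hr1.le
    generalize ((2 - lam q) / (2 + lam q)) ^ (k + 1) = x at *
    have hd : 0 < lam q + 1 + (lam q - 1) * x := by nlinarith
    have hy : -1 < tauE (lam q) p k := by
      rw [ih, lt_div_iff₀ hd]
      nlinarith
    rw [tauE, tauE_step hp hq hy, ih]
    generalize lam q = l at *
    have hl : 0 < 2 + l := by linarith
    have hne := hd.ne'
    have hcancel := div_mul_cancel₀ (-(1 + x)) hne
    have hr := mul_div_cancel₀ (2 - l) hl.ne'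
    have hnum : -((l ^ 2 - 2) * (-(1 + x) / (l + 1 + (l - 1) * x)) + l) =
        -((2 + l) * (1 + x * ((2 - l) / (2 + l)))) / (l + 1 + (l - 1) * x) := by
      rw [eq_div_iff hne]
      linear_combination (2 - l ^ 2) * hcancel + x * hr
    have hden : (l ^ 3 - l) * (-(1 + x) / (l + 1 + (l - 1) * x)) + (l ^ 2 + 2) =
        (2 + l) * (l + 1 + (l - 1) * (x * ((2 - l) / (2 + l)))) / (l + 1 + (l - 1) * x) := by
      rw [eq_div_iff hne]
      linear_combination (l ^ 3 - l) * hcancel - (l - 1) * x * hr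
    rw [hnum, hden, div_div_div_cancel_right₀ hne, ← mul_neg, mul_div_mul_left _ _ hl.ne']

/-- `(τ_k)` increases to `-1/(λ+1)` and `(c_k)` decreases to `1/2` (even case). -/
theorem tau_and_c_limits_even (q p : ℕ) (hp : 2 ≤ p) (hq : q = 2 * p) :
    StrictMono (tauE (lam q) p) ∧
    Tendsto (tauE (lam q) p) atTop (𝓝 (-1 / (lam q + 1))) ∧
    StrictAnti (fun k : ℕ =>
      -(tauE (lam q) p k) / (1 + (lam q - 1) * tauE (lam q) p k)) ∧
    Tendsto (fun k : ℕ =>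
      -(tauE (lam q) p k) / (1 + (lam q - 1) * tauE (lam q) p k)) atTop (𝓝 (1 / 2)) := by
  have h1 : 1 < lam q :=
    Real.one_lt_sqrt_two.trans_le (sqrt_two_le_lam (by omega))
  have h2 : lam q < 2 := lam_lt_two (by omega)
  have hτ := tauE_eq hp hq
  generalize lam q = l at *
  set r := (2 - l) / (2 + l)
  have hr0 : 0 < r := div_pos (by linarith) (by linarith)
  have hr1 : r < 1 := by rw [div_lt_one (by linarith)]; linarith
  have hd : ∀ k : ℕ, 0 < (l + 1) + (l - 1) * r ^ (k + 1) := fun k => by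
    have := pow_pos hr0 (k + 1)
    nlinarith
  have hc : ∀ k : ℕ, -(tauE l p k) / (1 + (l - 1) * tauE l p k) = (1 + r ^ (k + 1)) / 2 := by
    intro k
    have hk := (hd k).ne'
    rw [hτ]
    have hden : 1 + (l - 1) * (-(1 + r ^ (k + 1)) / (l + 1 + (l - 1) * r ^ (k + 1))) =
        2 / (l + 1 + (l - 1) * r ^ (k + 1)) := by
      field_simp
      ring
    rw [hden, ← neg_div, neg_neg, div_div_div_cancel_right₀ hk]
  have hanti : StrictAnti fun k : ℕ => r ^ (k + 1) :=
    (pow_right_strictAnti₀ hr0 hr1).comp_strictMono fun _ _ h => Nat.succ_lt_succ h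
  have hlim : Tendsto (fun k : ℕ => r ^ (k + 1)) atTop (𝓝 0) :=
    (tendsto_pow_atTop_nhds_zero_of_lt_one hr0.le hr1).comp (tendsto_add_atTop_nat 1)
  refine ⟨fun a b hab => ?_, ?_, fun a b hab => ?_, ?_⟩
  · have hlt : r ^ (b + 1) < r ^ (a + 1) := hanti hab
    rw [hτ, hτ, div_lt_div_iff₀ (hd a) (hd b)]
    nlinarith
  · rw [funext hτ]
    have hnum : Tendsto (fun k : ℕ => -(1 + r ^ (k + 1))) atTop (𝓝 (-(1 + 0))) :=
      (hlim.const_add 1).neg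
    have hden : Tendsto (fun k : ℕ => (l + 1) + (l - 1) * r ^ (k + 1)) atTop
        (𝓝 ((l + 1) + (l - 1) * 0)) := (hlim.const_mul _).const_add _
    have hquot := hnum.div hden (by linarith)
    rwa [add_zero, mul_zero, add_zero] at hquot
  · have hlt : r ^ (b + 1) < r ^ (a + 1) := hanti hab
    simp only [hc]
    linarith
  · simp only [hc]
    simpa using (hlim.const_add 1).div_const 2

end RosenTong
end
end

section
/- Fix an even integer q = 2p with p ≥ 3, let λ = 2·cos(π/q), and let k ≥ 0. Then ∫_{t = τ_k}^{−1/(λ+1)} ∫_{v = −2−1/t}^{λ−1} (1 + tv)^{−2} dv dt = ((−λ−1)·τ_k − 1)/(2τ_k) + log|2τ_k/((λ−1)·τ_k + 1)|. Consequently ν(A_k) = C_q · [ ((−λ−1)·τ_k − 1)/(2τ_k) + log|2τ_k/((λ−1)·τ_k + 1)| ], where A_k = {(t,v) ∈ D : τ_k ≤ t ≤ −1/(λ+1)}. -/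
noncomputable section

open Real Filter Topology MeasureTheory
open scoped Classical

namespace RosenTong

/-- The heights satisfy `L_j = sin((2j-1)θ/2) / sin((2j+1)θ/2)` for `λ = 2 cos θ`, `θ = 2a`. -/
theorem LE_succ_eq (a : ℝ) (n : ℕ) (ha : 0 < a) (hn : (2 * n + 3) * a < Real.pi) :
    LE (2 * Real.cos (2 * a)) (n + 1) =
      Real.sin ((2 * n + 1) * a) / Real.sin ((2 * n + 3) * a) := by
  induction n with
  | zero =>
    have h1 : 0 < Real.sin a := Real.sin_pos_of_pos_of_lt_pi ha (by norm_num at hn; linarith)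
    have h3 : 0 < Real.sin (3 * a) :=
      Real.sin_pos_of_pos_of_lt_pi (by positivity) (by norm_num at hn; linarith)
    have e : Real.sin (3 * a) = Real.sin a * (2 * Real.cos (2 * a) + 1) := by
      rw [Real.sin_three_mul, Real.cos_two_mul, Real.cos_sq']; ring
    have h4 : 0 < 2 * Real.cos (2 * a) + 1 := by
      rw [e] at h3; exact (pos_iff_pos_of_mul_pos h3).1 h1
    simp only [LE, Nat.cast_zero, mul_zero, zero_add, one_mul]
    rw [e]
    field_simp
  | succ n ih =>
    push_cast at hn ⊢
    have hna : 0 ≤ n * a := by positivity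
    have h3 : 0 < Real.sin ((2 * n + 3) * a) :=
      Real.sin_pos_of_pos_of_lt_pi (by positivity) (by linarith)
    have e : 2 * Real.cos (2 * a) * Real.sin ((2 * n + 3) * a) - Real.sin ((2 * n + 1) * a) =
        Real.sin ((2 * (n + 1) + 3) * a) := by
      rw [show (2 * n + 1) * a = (2 * n + 3) * a - 2 * a by ring,
        show (2 * ((n : ℝ) + 1) + 3) * a = (2 * n + 3) * a + 2 * a by ring,
        Real.sin_sub, Real.sin_add]
      ring
    have e2 : 2 * Real.cos (2 * a) - Real.sin ((2 * n + 1) * a) / Real.sin ((2 * n + 3) * a) =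
        Real.sin ((2 * (n + 1) + 3) * a) / Real.sin ((2 * n + 3) * a) := by
      rw [← e, sub_div, mul_div_cancel_right₀ _ h3.ne']
    rw [LE, ih (by linarith), e2, one_div_div]
    congr 2; ring

theorem cos_nat_mul_pos {a : ℝ} {p j : ℕ} (hp : p * a = Real.pi / 2) (ha : 0 < a) (hj : j < p) :
    0 < Real.cos (j * a) := by
  apply Real.cos_pos_of_mem_Ioo
  have : (j : ℝ) < p := by exact_mod_cast hj
  have h0 : 0 ≤ (j : ℝ) * a := by positivity
  constructor <;> nlinarith [Real.pi_pos]

theorem cos_nat_mul_nonneg {a : ℝ} {p j : ℕ} (hp : p * a = Real.pi / 2) (ha : 0 < a) (hj : j ≤ p) :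
    0 ≤ Real.cos (j * a) := by
  rcases hj.lt_or_eq with h | rfl
  · exact (cos_nat_mul_pos hp ha h).le
  · rw [hp, Real.cos_pi_div_two]

theorem two_cos_mul_cos_succ (a : ℝ) (j : ℕ) :
    2 * Real.cos a * Real.cos ((j + 1 : ℕ) * a) =
      Real.cos (j * a) + Real.cos ((j + 2 : ℕ) * a) := by
  push_cast
  rw [show (j : ℝ) * a = (j + 1) * a - a by ring,
    show ((j : ℝ) + 2) * a = (j + 1) * a + a by ring, Real.cos_sub, Real.cos_add]
  ring

/-- The orbit of `-λ/2` under the Rosen map, for `λ = 2 cos(π/2p)`. -/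
theorem phi_eq {a : ℝ} {p : ℕ} (hp : p * a = Real.pi / 2) (ha : 0 < a) (j : ℕ) (hj : j < p) :
    phi (2 * Real.cos a) j = -(Real.cos ((j + 1 : ℕ) * a) / Real.cos (j * a)) := by
  induction j with
  | zero => simp [phi]
  | succ j ih =>
    have c0 := cos_nat_mul_pos hp ha (show j < p by omega)
    have c1 := cos_nat_mul_pos hp ha hj
    have c2 := cos_nat_mul_nonneg hp ha (show j + 2 ≤ p by omega)
    have hc : 0 < Real.cos a := by simpa using cos_nat_mul_pos hp ha (show 1 < p by omega)
    have key := two_cos_mul_cos_succ a j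
    have c20 : Real.cos ((j + 2 : ℕ) * a) ≤ Real.cos (j * a) := by
      apply Real.cos_le_cos_of_nonneg_of_le_pi (by positivity)
      · have : ((j + 2 : ℕ) : ℝ) ≤ p := by exact_mod_cast (show j + 2 ≤ p by omega)
        nlinarith [Real.pi_pos]
      · push_cast; nlinarith
    have step : phi (2 * Real.cos a) (j + 1) = f (2 * Real.cos a) (phi (2 * Real.cos a) j) := by
      simp only [phi, Function.iterate_succ', Function.comp_apply]
    rw [step, ih (by omega)]
    generalize Real.cos ((j : ℕ) * a) = x at *
    rw [show j + 1 + 1 = j + 2 from rfl]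
    generalize Real.cos ((j + 1 : ℕ) * a) = y at *
    generalize Real.cos ((j + 2 : ℕ) * a) = z at *
    generalize Real.cos a = c at *
    have hpos : 0 < y / x := by positivity
    have hfl : ⌊1 / (2 * c * (y / x)) + 1 / 2⌋ = 1 := by
      rw [show 2 * c * (y / x) = (x + z) / x by rw [← key]; ring, one_div_div, Int.floor_eq_iff]
      have hxz : 0 < x + z := by linarith
      constructor
      · have : 1 / 2 ≤ x / (x + z) := by rw [div_le_div_iff₀ two_pos hxz]; linarith
        push_cast; linarith
      · have : x / (x + z) ≤ 1 := by rw [div_le_one hxz]; linarith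
        push_cast; linarith
    rw [f, if_neg (neg_ne_zero.2 hpos.ne'), abs_neg, abs_of_pos hpos, hfl]
    push_cast
    field_simp
    linarith

theorem G_phi {a : ℝ} {p : ℕ} (hp : p * a = Real.pi / 2) (ha : 0 < a) (j : ℕ) (hj : j + 1 < p) :
    G (2 * Real.cos a) (phi (2 * Real.cos a) (j + 1)) = phi (2 * Real.cos a) j := by
  have c0 := cos_nat_mul_pos hp ha (show j < p by omega)
  have c1 := cos_nat_mul_pos hp ha hj
  have key := two_cos_mul_cos_succ a j
  rw [phi_eq hp ha _ hj, phi_eq hp ha _ (by omega), G, show j + 1 + 1 = j + 2 from rfl,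
    show 2 * Real.cos a + -(Real.cos ((j + 2 : ℕ) * a) / Real.cos ((j + 1 : ℕ) * a)) =
      Real.cos (j * a) / Real.cos ((j + 1 : ℕ) * a) by
        rw [← sub_eq_add_neg, eq_div_iff c1.ne', sub_mul, div_mul_cancel₀ _ c1.ne']; linarith]
  field_simp

theorem phi_mem {a : ℝ} {p : ℕ} (hp : p * a = Real.pi / 2) (ha : 0 < a) (j : ℕ) (hj : j + 1 < p) :
    -(2 * Real.cos a) < phi (2 * Real.cos a) j ∧
      phi (2 * Real.cos a) j ≤ -1 / (2 * Real.cos a) := by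
  have c0 := cos_nat_mul_pos hp ha (show j < p by omega)
  have c1 := cos_nat_mul_pos hp ha hj
  have hc : 0 < Real.cos a := by simpa using cos_nat_mul_pos hp ha (show 1 < p by omega)
  constructor
  · cases j with
    | zero => simp [phi]; linarith
    | succ j =>
      have key := two_cos_mul_cos_succ a j
      have c := cos_nat_mul_pos hp ha (show j < p by omega)
      rw [phi_eq hp ha _ (by omega), neg_lt_neg_iff, div_lt_iff₀ c0, key]
      linarith
  · have key := two_cos_mul_cos_succ a j
    have c2 := cos_nat_mul_nonneg hp ha (show j + 2 ≤ p by omega)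
    rw [phi_eq hp ha _ (by omega), neg_div, neg_le_neg_iff, div_le_div_iff₀ (by positivity) c0]
    linarith

theorem G_mono {l x y : ℝ} (hx : -l < x) (hxy : x ≤ y) : G l x ≤ G l y := by
  unfold G
  rw [neg_div, neg_div, neg_le_neg_iff]
  exact one_div_le_one_div_of_le (by linarith) (by linarith)

theorem phi_le_G_iterate {a : ℝ} {p : ℕ} (hp : p * a = Real.pi / 2) (ha : 0 < a) {t : ℝ} (n j : ℕ)
    (hj : n + j + 1 < p) (ht : phi (2 * Real.cos a) (n + j) ≤ t) :
    phi (2 * Real.cos a) j ≤ (G (2 * Real.cos a))^[n] t := by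
  induction n generalizing j with
  | zero => simpa using ht
  | succ n ih =>
    rw [Function.iterate_succ_apply', ← G_phi hp ha j (by omega)]
    refine G_mono (phi_mem hp ha _ (by omega)).1 (ih (j + 1) (by omega) ?_)
    rwa [show n + (j + 1) = n + 1 + j by ring]

theorem G_iterate_le_neg_LE {l t : ℝ} (ht : t ≤ -LE l 1) (n : ℕ)
    (h : ∀ m < n, -l < (G l)^[m] t) : (G l)^[n] t ≤ -LE l (n + 1) := by
  induction n with
  | zero => simpa using ht
  | succ n ih =>
    rw [Function.iterate_succ_apply']
    refine (G_mono (h n (by omega)) (ih fun m hm => h m (by omega))).trans_eq ?_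
    rw [LE, G, neg_div, sub_eq_add_neg]

section Even

variable {a : ℝ} {p : ℕ}

theorem lam_bounds (hp3 : 3 ≤ p) (hp : p * a = Real.pi / 2) (ha : 0 < a) :
    3 ≤ (2 * Real.cos a) ^ 2 ∧ 17 / 10 < 2 * Real.cos a ∧ 2 * Real.cos a < 2 := by
  have h3 : (3 : ℝ) ≤ p := by exact_mod_cast hp3
  have ha6 : a ≤ Real.pi / 6 := by nlinarith
  have h1 : √3 / 2 ≤ Real.cos a := by
    rw [← Real.cos_pi_div_six]
    exact Real.cos_le_cos_of_nonneg_of_le_pi ha.le (by linarith [Real.pi_pos]) ha6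
  have h2 : Real.cos a < 1 := by
    rw [← Real.cos_zero]
    exact Real.cos_lt_cos_of_nonneg_of_le_pi le_rfl (by linarith [Real.pi_pos]) ha
  have hs : √3 ^ 2 = 3 := Real.sq_sqrt (by norm_num)
  have hs0 := Real.sqrt_nonneg 3
  refine ⟨by nlinarith, ?_, by linarith⟩
  nlinarith

theorem phi_penultimate (hp3 : 3 ≤ p) (hp : p * a = Real.pi / 2) (ha : 0 < a) :
    phi (2 * Real.cos a) (p - 2) = -1 / (2 * Real.cos a) := by
  have key := two_cos_mul_cos_succ a (p - 2)
  have c0 := cos_nat_mul_pos hp ha (show p - 2 < p by omega)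
  have hc : 0 < Real.cos a := by simpa using cos_nat_mul_pos hp ha (show 1 < p by omega)
  rw [show p - 2 + 2 = p by omega, hp, Real.cos_pi_div_two, add_zero] at key
  rw [phi_eq hp ha _ (by omega), neg_div, neg_inj, div_eq_div_iff c0.ne' (by positivity)]
  linarith

theorem phi_last (hp3 : 3 ≤ p) (hp : p * a = Real.pi / 2) (ha : 0 < a) :
    phi (2 * Real.cos a) (p - 1) = 0 := by
  rw [phi_eq hp ha _ (by omega), show p - 1 + 1 = p by omega, hp, Real.cos_pi_div_two]
  simp

theorem LE_last (hp3 : 3 ≤ p) (hp : p * a = Real.pi / 2) (ha : 0 < a) :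
    LE (2 * Real.cos a) (p - 1) = 2 * Real.cos a - 1 := by
  obtain ⟨n, rfl⟩ : ∃ n, p = n + 2 := ⟨p - 2, by omega⟩
  push_cast at hp
  have hna : 0 ≤ n * a := by positivity
  have h := LE_succ_eq (a / 2) n (by positivity) (by linarith [Real.pi_pos])
  rw [mul_div_cancel₀ a two_ne_zero] at h
  rw [show n + 2 - 1 = n + 1 from rfl, h,
    show (2 * n + 1) * (a / 2) = Real.pi / 2 - 3 * (a / 2) by rw [← hp]; ring,
    show (2 * n + 3) * (a / 2) = Real.pi / 2 - a / 2 by rw [← hp]; ring,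
    Real.sin_pi_div_two_sub, Real.sin_pi_div_two_sub]
  have hc : 0 < Real.cos (a / 2) := Real.cos_pos_of_mem_Ioo ⟨by linarith [Real.pi_pos], by linarith⟩
  have e : Real.cos a = 2 * Real.cos (a / 2) ^ 2 - 1 := by
    rw [← Real.cos_two_mul, mul_div_cancel₀ a two_ne_zero]
  rw [Real.cos_three_mul, e]
  field_simp
  ring

theorem tauE_mem (hp3 : 3 ≤ p) (hp : p * a = Real.pi / 2) (ha : 0 < a) (k : ℕ) :
    -2 / (3 * (2 * Real.cos a)) ≤ tauE (2 * Real.cos a) p k ∧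
      tauE (2 * Real.cos a) p k ≤ -1 / (2 * Real.cos a + 1) := by
  obtain ⟨-, hl1, hl2⟩ := lam_bounds hp3 hp ha
  induction k with
  | zero =>
    refine ⟨le_rfl, ?_⟩
    rw [tauE, div_le_div_iff₀ (by linarith) (by linarith)]
    linarith
  | succ k ih =>
    have hφ : phi (2 * Real.cos a) (p - 2) ≤ tauE (2 * Real.cos a) p k := by
      rw [phi_penultimate hp3 hp ha]
      refine le_trans ?_ ih.1
      rw [div_le_div_iff₀ (by linarith) (by linarith)]
      linarith
    have lower := phi_le_G_iterate hp ha (p - 2) 0 (by omega) hφ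
    have upper := G_iterate_le_neg_LE (l := 2 * Real.cos a) (t := tauE (2 * Real.cos a) p k)
      (by rw [LE, ← neg_div]; exact ih.2) (p - 2) fun m hm =>
        (phi_mem hp ha (p - 2 - m) (by omega)).1.trans_le
          (phi_le_G_iterate hp ha m (p - 2 - m) (by omega)
            (by rwa [show m + (p - 2 - m) = p - 2 by omega]))
    rw [show p - 2 + 1 = p - 1 by omega, LE_last hp3 hp ha] at upper
    simp only [phi, Function.iterate_zero, id_eq] at lower
    rw [tauE]
    generalize (G (2 * Real.cos a))^[p - 2] (tauE (2 * Real.cos a) p k) = g at *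
    generalize 2 * Real.cos a = l at *
    constructor
    · rw [div_le_div_iff₀ (by linarith) (by linarith)]; linarith
    · rw [div_le_div_iff₀ (by linarith) (by linarith)]; linarith

theorem mem_OmegaE_iff (hp3 : 3 ≤ p) (hp : p * a = Real.pi / 2) (ha : 0 < a) {t v : ℝ}
    (ht : -1 / (2 * Real.cos a) ≤ t) (ht0 : t < 0) :
    (t, v) ∈ OmegaE (2 * Real.cos a) p ↔ 0 ≤ v ∧ v ≤ 2 * Real.cos a - 1 := by
  simp only [OmegaE, Set.mem_union, Set.mem_iUnion, Set.mem_prod, Set.mem_Ico, Set.mem_Icc,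
    Finset.mem_Icc, exists_prop]
  constructor
  · rintro (⟨j, ⟨h1, h2⟩, ⟨h3, h4⟩, h5⟩ | ⟨⟨h1, -⟩, -⟩)
    · rcases h2.lt_or_eq with h | rfl
      · exact absurd h4 (not_lt.2 ((phi_mem hp ha j (by omega)).2.trans ht))
      · rwa [LE_last hp3 hp ha] at h5
    · linarith
  · intro hv
    refine Or.inl ⟨p - 1, by omega, ⟨?_, ?_⟩, ?_⟩
    · rwa [show p - 1 - 1 = p - 2 by omega, phi_penultimate hp3 hp ha]
    · rwa [phi_last hp3 hp ha]
    · rwa [LE_last hp3 hp ha]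

end Even

/-- The slice of `A_k` in the range where `Ω` has height `λ - 1`. -/
theorem mem_DE_iff {a : ℝ} {p : ℕ} (hp3 : 3 ≤ p) (hp : p * a = Real.pi / 2) (ha : 0 < a) {t v : ℝ}
    (ht : -2 / (3 * (2 * Real.cos a)) ≤ t) (ht0 : t < 0) :
    (t, v) ∈ DE (2 * Real.cos a) p ↔ -2 - 1 / t < v ∧ v ≤ 2 * Real.cos a - 1 := by
  obtain ⟨hl3, hl1, hl2⟩ := lam_bounds hp3 hp ha
  have ht1 : -1 / (2 * Real.cos a) ≤ t := by
    refine le_trans ?_ ht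
    rw [div_le_div_iff₀ (by linarith) (by linarith)]
    linarith
  rw [DE, Set.mem_sep_iff, mem_OmegaE_iff hp3 hp ha ht1 ht0]
  rw [div_le_iff₀ (by linarith)] at ht
  generalize 2 * Real.cos a = l at *
  have ht4 : -(2 / 5) < t := by nlinarith
  have e : 1 / t * t = 1 := div_mul_cancel₀ _ ht0.ne
  have lower : ∀ w, -2 - 1 / t < w ↔ t * w < -2 * t - 1 := by
    intro w
    constructor
    · intro h; nlinarith
    · intro h; by_contra! hw; nlinarith
  rw [lower, abs_of_neg ht0]
  constructor
  · rintro ⟨⟨h1, h2⟩, h3, h4⟩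
    refine ⟨?_, h2⟩
    have hpos : 0 < 1 + t * v := by nlinarith
    rw [gt_iff_lt, div_lt_div_iff₀ two_pos hpos] at h4
    linarith
  · rintro ⟨h1, h2⟩
    have hv : 0 ≤ v := by by_contra! hv; nlinarith
    have hpos : 0 < 1 + t * v := by nlinarith
    refine ⟨⟨hv, h2⟩, ?_, ?_⟩
    · rw [gt_iff_lt, div_lt_div_iff₀ two_pos hpos]
      by_contra! hw
      nlinarith [mul_le_mul_of_nonpos_left hw ht0.le]
    · rw [gt_iff_lt, div_lt_div_iff₀ two_pos hpos]
      linarith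

/-- Positivity of `1 + tv` below height `λ - 1`. -/
theorem one_add_mul_pos {l t v : ℝ} (hl1 : 1 < l) (ht : -2 / (3 * l) ≤ t) (ht0 : t < 0)
    (hv : v ≤ l - 1) : 0 < 1 + t * v := by
  rw [div_le_iff₀ (by linarith)] at ht
  nlinarith

/-- The slice over `t ≤ -1/(λ+1)` is a genuine interval. -/
theorem neg_two_sub_one_div_le {l t : ℝ} (hl1 : 1 < l) (ht : t ≤ -1 / (l + 1)) :
    t < 0 ∧ -2 - 1 / t ≤ l - 1 := by
  have h0 : t < 0 := ht.trans_lt (div_neg_of_neg_of_pos (by norm_num) (by linarith))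
  rw [le_div_iff₀ (by linarith)] at ht
  have : -(l + 1) ≤ 1 / t := by rw [le_div_iff_of_neg h0]; linarith
  exact ⟨h0, by linarith⟩

theorem inner_integral {l t : ℝ} (hl1 : 1 < l) (ht : -2 / (3 * l) ≤ t) (ht0 : t < 0)
    (hle : -2 - 1 / t ≤ l - 1) :
    IntervalIntegrable (fun v => (1 + t * v) ^ (-2 : ℤ)) volume (-2 - 1 / t) (l - 1) ∧
    ∫ v in (-2 - 1 / t)..(l - 1), (1 + t * v) ^ (-2 : ℤ) =
      (l - 1) / (1 + (l - 1) * t) - 1 / t - 1 / (2 * t ^ 2) := by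
  have hpos : ∀ v ∈ Set.uIcc (-2 - 1 / t) (l - 1), 0 < 1 + t * v := by
    intro v hv
    rw [Set.uIcc_of_le hle] at hv
    exact one_add_mul_pos hl1 ht ht0 hv.2
  have hint : IntervalIntegrable (fun v => (1 + t * v) ^ (-2 : ℤ)) volume
      (-2 - 1 / t) (l - 1) := by
    apply ContinuousOn.intervalIntegrable
    exact ContinuousOn.zpow₀ (by fun_prop) _ fun v hv => Or.inl (hpos v hv).ne'
  refine ⟨hint, ?_⟩
  rw [intervalIntegral.integral_eq_sub_of_hasDerivAt (f := fun v => v / (1 + t * v)) _ hint]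
  · have h1 : (0 : ℝ) < 1 + t * (l - 1) := hpos _ Set.right_mem_uIcc
    have h2 : 1 + t * (-2 - 1 / t) = -2 * t := by field_simp [ht0.ne]; ring
    have h3 : (-2 - 1 / t) / (-2 * t) = 1 / t + 1 / (2 * t ^ 2) := by field_simp [ht0.ne]; ring
    simp only [h2, h3]
    rw [mul_comm t]
    ring
  · intro v hv
    have h := hpos v hv
    have hd : HasDerivAt (fun v => 1 + t * v) t v := by
      simpa using ((hasDerivAt_id v).const_mul t).const_add 1
    refine ((hasDerivAt_id' v).div hd h.ne').congr_deriv ?_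
    rw [zpow_neg, ← one_div]
    congr 1
    ring

theorem outer_integral {l s : ℝ} (hl1 : 1 < l) (hs : -2 / (3 * l) ≤ s) (hs1 : s ≤ -1 / (l + 1)) :
    IntervalIntegrable (fun t => (l - 1) / (1 + (l - 1) * t) - 1 / t - 1 / (2 * t ^ 2)) volume
      s (-1 / (l + 1)) ∧
    ∫ t in s..(-1 / (l + 1)), ((l - 1) / (1 + (l - 1) * t) - 1 / t - 1 / (2 * t ^ 2)) =
      ((-l - 1) * s - 1) / (2 * s) + Real.log |2 * s / ((l - 1) * s + 1)| := by
  have hb : -1 / (l + 1) < 0 := div_neg_of_neg_of_pos (by norm_num) (by linarith)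
  have hpos : ∀ t ∈ Set.uIcc s (-1 / (l + 1)), t < 0 ∧ 0 < 1 + (l - 1) * t := by
    intro t ht
    rw [Set.uIcc_of_le hs1] at ht
    have h0 : t < 0 := ht.2.trans_lt hb
    refine ⟨h0, ?_⟩
    rw [mul_comm]
    exact one_add_mul_pos hl1 (hs.trans ht.1) h0 le_rfl
  have hint : IntervalIntegrable
      (fun t => (l - 1) / (1 + (l - 1) * t) - 1 / t - 1 / (2 * t ^ 2)) volume
      s (-1 / (l + 1)) := by
    apply ContinuousOn.intervalIntegrable
    refine ((ContinuousOn.div (by fun_prop) (by fun_prop) fun t ht => (hpos t ht).2.ne').sub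
      (ContinuousOn.div (by fun_prop) (by fun_prop) fun t ht => (hpos t ht).1.ne)).sub
      (ContinuousOn.div (by fun_prop) (by fun_prop) fun t ht => ?_)
    have := (hpos t ht).1.ne
    positivity
  refine ⟨hint, ?_⟩
  rw [intervalIntegral.integral_eq_sub_of_hasDerivAt
    (f := fun t => Real.log (1 + (l - 1) * t) - Real.log t + 1 / (2 * t)) _ hint]
  · obtain ⟨h1, h2⟩ := hpos s Set.left_mem_uIcc
    have e1 : 1 + (l - 1) * (-1 / (l + 1)) = 2 / (l + 1) := by field_simp; ring
    have e2 : Real.log (-1 / (l + 1)) = -Real.log (l + 1) := by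
      rw [neg_div, Real.log_neg_eq_log, one_div, Real.log_inv]
    have e3 : 1 / (2 * (-1 / (l + 1))) = -(l + 1) / 2 := by field_simp
    have e4 : Real.log |2 * s / ((l - 1) * s + 1)| =
        Real.log 2 + Real.log s - Real.log (1 + (l - 1) * s) := by
      rw [Real.log_abs, add_comm _ (1 : ℝ), Real.log_div (by simpa using h1.ne) h2.ne',
        Real.log_mul two_ne_zero h1.ne]
    simp only [e1, e2, e3, e4]
    rw [Real.log_div two_ne_zero (by linarith)]
    field_simp [h1.ne]
    ring
  · intro t ht
    obtain ⟨h1, h2⟩ := hpos t ht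
    have hd : HasDerivAt (fun t => 1 + (l - 1) * t) (l - 1) t := by
      simpa using ((hasDerivAt_id t).const_mul (l - 1)).const_add 1
    have h3 : HasDerivAt (fun t : ℝ => 1 / (2 * t)) (-(1 / (2 * t ^ 2))) t := by
      simp only [one_div]
      refine (((hasDerivAt_id' t).const_mul 2).inv (by simpa using h1.ne)).congr_deriv ?_
      field_simp [h1.ne]
    refine (((hd.log h2.ne').sub (Real.hasDerivAt_log h1.ne)).add h3).congr_deriv ?_
    rw [one_div t]
    ring

theorem lintegral_ofReal_Ioc {g : ℝ → ℝ} {x y : ℝ} (hxy : x ≤ y)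
    (hg : IntervalIntegrable g volume x y) (h0 : ∀ t ∈ Set.Ioc x y, 0 ≤ g t) :
    ∫⁻ t in Set.Ioc x y, ENNReal.ofReal (g t) = ENNReal.ofReal (∫ t in x..y, g t) := by
  rw [intervalIntegral.integral_of_le hxy, ofReal_integral_eq_lintegral_ofReal]
  · exact (intervalIntegrable_iff_integrableOn_Ioc_of_le hxy).1 hg
  · exact (ae_restrict_iff' measurableSet_Ioc).2 (Eventually.of_forall h0)

/-- the integral of `(1 + tv)⁻²` over the region below height `λ - 1` cut out by `|t| > (1+tv)/2`,
as a Lebesgue integral on the plane. -/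
theorem lintegral_region {l s C : ℝ} (hl1 : 1 < l) (hs : -2 / (3 * l) ≤ s)
    (hs1 : s ≤ -1 / (l + 1)) (hC : 0 ≤ C) {B : Set (ℝ × ℝ)} (hB : MeasurableSet B)
    (hmem : ∀ t v, (t, v) ∈ B ↔
      (s ≤ t ∧ t ≤ -1 / (l + 1)) ∧ (-2 - 1 / t < v ∧ v ≤ l - 1)) :
    ∫⁻ z in B, ENNReal.ofReal (C / (1 + z.1 * z.2) ^ 2) =
      ENNReal.ofReal (C * (((-l - 1) * s - 1) / (2 * s) +
        Real.log |2 * s / ((l - 1) * s + 1)|)) := by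
  have hb : -1 / (l + 1) < 0 := div_neg_of_neg_of_pos (by norm_num) (by linarith)
  have hslice : ∀ t ∈ Set.Icc s (-1 / (l + 1)), -2 - 1 / t ≤ l - 1 :=
    fun t ht => (neg_two_sub_one_div_le hl1 ht.2).2
  set F : ℝ → ℝ := fun t => (l - 1) / (1 + (l - 1) * t) - 1 / t - 1 / (2 * t ^ 2) with hF
  have hinner : ∀ t ∈ Set.Icc s (-1 / (l + 1)), 0 ≤ C * F t ∧
      ∫⁻ v in Set.Ioc (-2 - 1 / t) (l - 1), ENNReal.ofReal (C / (1 + t * v) ^ 2) =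
        ENNReal.ofReal (C * F t) := by
    intro t ht
    obtain ⟨h1, h2⟩ := inner_integral hl1 (hs.trans ht.1) (ht.2.trans_lt hb) (hslice t ht)
    have hnn : ∀ v, 0 ≤ (1 + t * v) ^ (-2 : ℤ) := fun v => (even_two.neg).zpow_nonneg _
    have h3 : 0 ≤ F t := by
      rw [hF]; dsimp only; rw [← h2]
      exact intervalIntegral.integral_nonneg (hslice t ht) fun v _ => hnn v
    refine ⟨mul_nonneg hC h3, ?_⟩
    rw [hF]; dsimp only
    rw [← h2, ← intervalIntegral.integral_const_mul,
      ← lintegral_ofReal_Ioc (hslice t ht) (h1.const_mul C) fun v _ => mul_nonneg hC (hnn v)]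
    refine lintegral_congr fun v => ?_
    rw [zpow_neg, div_eq_mul_inv]
    rfl
  obtain ⟨h1, h2⟩ := outer_integral hl1 hs hs1
  rw [← lintegral_indicator hB, Measure.volume_eq_prod, lintegral_prod _ (by
    refine (Measurable.indicator ?_ hB).aemeasurable
    fun_prop)]
  have hfib : ∀ t, ∫⁻ v, B.indicator (fun z => ENNReal.ofReal (C / (1 + z.1 * z.2) ^ 2)) (t, v) =
      (Set.Icc s (-1 / (l + 1))).indicator (fun t => ENNReal.ofReal (C * F t)) t := by
    intro t
    by_cases ht : t ∈ Set.Icc s (-1 / (l + 1))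
    · rw [Set.indicator_of_mem ht, ← (hinner t ht).2, ← lintegral_indicator measurableSet_Ioc]
      refine lintegral_congr fun v => ?_
      simp only [Set.indicator_apply, hmem, Set.mem_Ioc]
      exact if_congr (and_iff_right ht) rfl rfl
    · rw [Set.indicator_of_notMem ht, ← lintegral_zero (μ := (volume : Measure ℝ))]
      refine lintegral_congr fun v => Set.indicator_of_notMem ?_ _
      rw [hmem]
      exact fun h => ht h.1
  simp only [hfib]
  rw [lintegral_indicator measurableSet_Icc, setLIntegral_congr Ioc_ae_eq_Icc.symm,
    lintegral_ofReal_Ioc hs1 (h1.const_mul C) fun t ht => (hinner t ⟨ht.1.le, ht.2⟩).1,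
    intervalIntegral.integral_const_mul, h2]

theorem log_one_add_cos_div_sin_pos {a : ℝ} (ha : 0 < a) (ha2 : a < Real.pi / 2) :
    0 < Real.log ((1 + Real.cos a) / Real.sin a) := by
  apply Real.log_pos
  have h1 : 0 < Real.sin a := Real.sin_pos_of_pos_of_lt_pi ha (by linarith)
  have h2 : 0 < Real.cos a := Real.cos_pos_of_mem_Ioo ⟨by linarith, ha2⟩
  rw [one_lt_div h1]
  linarith [Real.sin_le_one a]

/-- the measure of the region `A_k` (even case). -/
theorem measure_Ak_even (q p : ℕ) (hp : 3 ≤ p) (hq : q = 2 * p) (k : ℕ) :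
    (∫ t in (tauE (lam q) p k)..(-1 / (lam q + 1)),
        ∫ v in (-2 - 1 / t)..(lam q - 1), (1 + t * v) ^ (-2 : ℤ)) =
      ((-lam q - 1) * tauE (lam q) p k - 1) / (2 * tauE (lam q) p k) +
        Real.log |2 * tauE (lam q) p k / ((lam q - 1) * tauE (lam q) p k + 1)| ∧
    (nuE q p {z ∈ DE (lam q) p | tauE (lam q) p k ≤ z.1 ∧ z.1 ≤ -1 / (lam q + 1)}).toReal =
      (1 / Real.log ((1 + Real.cos (Real.pi / q)) / Real.sin (Real.pi / q))) *
        (((-lam q - 1) * tauE (lam q) p k - 1) / (2 * tauE (lam q) p k) +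
          Real.log |2 * tauE (lam q) p k / ((lam q - 1) * tauE (lam q) p k + 1)|) := by
  obtain ⟨a, hadef⟩ : ∃ a : ℝ, a = Real.pi / q := ⟨_, rfl⟩
  have hp0 : (0 : ℝ) < p := by exact_mod_cast (show 0 < p by omega)
  have hpa : p * a = Real.pi / 2 := by rw [hadef, hq]; push_cast; field_simp
  have ha : 0 < a := by
    rw [hadef, hq]; push_cast; positivity
  have ha2 : a < Real.pi / 2 := by
    have : (3 : ℝ) ≤ p := by exact_mod_cast hp
    nlinarith
  have hlam : lam q = 2 * Real.cos a := by rw [lam, hadef]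
  obtain ⟨-, hl1, -⟩ := lam_bounds hp hpa ha
  obtain ⟨hs, hs1⟩ := tauE_mem hp hpa ha k
  have hC : 0 ≤ 1 / Real.log ((1 + Real.cos a) / Real.sin a) :=
    (one_div_pos.2 (log_one_add_cos_div_sin_pos ha ha2)).le
  rw [nuE, hlam, ← hadef]
  have hDE := fun t v => mem_DE_iff (t := t) (v := v) hp hpa ha
  have hΩ : DE (2 * Real.cos a) p ⊆ OmegaE (2 * Real.cos a) p := fun z hz => hz.1
  generalize tauE (2 * Real.cos a) p k = s at *
  generalize 1 / Real.log ((1 + Real.cos a) / Real.sin a) = C at *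
  generalize 2 * Real.cos a = l at *
  have hb : -1 / (l + 1) < 0 := div_neg_of_neg_of_pos (by norm_num) (by linarith)
  have hmem : ∀ t v, (t, v) ∈ {z ∈ DE l p | s ≤ z.1 ∧ z.1 ≤ -1 / (l + 1)} ↔
      (s ≤ t ∧ t ≤ -1 / (l + 1)) ∧ (-2 - 1 / t < v ∧ v ≤ l - 1) := by
    intro t v
    rw [Set.mem_sep_iff, and_comm]
    exact and_congr_right fun h => hDE t v (hs.trans h.1) (h.2.trans_lt hb)
  have hB : MeasurableSet {z ∈ DE l p | s ≤ z.1 ∧ z.1 ≤ -1 / (l + 1)} := by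
    rw [show {z ∈ DE l p | s ≤ z.1 ∧ z.1 ≤ -1 / (l + 1)} = {z : ℝ × ℝ |
      (s ≤ z.1 ∧ z.1 ≤ -1 / (l + 1)) ∧ (-2 - 1 / z.1 < z.2 ∧ z.2 ≤ l - 1)} from
        Set.ext fun z => hmem z.1 z.2]
    measurability
  have hslice : ∀ t ∈ Set.uIcc s (-1 / (l + 1)),
      ∫ v in (-2 - 1 / t)..(l - 1), (1 + t * v) ^ (-2 : ℤ) =
        (l - 1) / (1 + (l - 1) * t) - 1 / t - 1 / (2 * t ^ 2) := by
    intro t ht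
    rw [Set.uIcc_of_le hs1] at ht
    obtain ⟨h0, h1⟩ := neg_two_sub_one_div_le (by linarith) ht.2
    exact (inner_integral (by linarith) (hs.trans ht.1) h0 h1).2
  have hI : (∫ t in s..(-1 / (l + 1)),
        ∫ v in (-2 - 1 / t)..(l - 1), (1 + t * v) ^ (-2 : ℤ)) =
      ((-l - 1) * s - 1) / (2 * s) + Real.log |2 * s / ((l - 1) * s + 1)| := by
    rw [intervalIntegral.integral_congr hslice]
    exact (outer_integral (by linarith) hs hs1).2
  have hnn : 0 ≤ ((-l - 1) * s - 1) / (2 * s) + Real.log |2 * s / ((l - 1) * s + 1)| := by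
    rw [← hI]
    exact intervalIntegral.integral_nonneg hs1 fun t ht =>
      intervalIntegral.integral_nonneg (neg_two_sub_one_div_le (by linarith) ht.2).2
        fun v _ => even_two.neg.zpow_nonneg _
  refine ⟨hI, ?_⟩
  rw [withDensity_apply _ hB, Measure.restrict_restrict hB,
    Set.inter_eq_left.2 ((Set.sep_subset _ _).trans hΩ),
    lintegral_region (by linarith) hs hs1 hC hB hmem, ENNReal.toReal_ofReal (mul_nonneg hC hnn)]

end RosenTong
end
end
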